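/- For all z ≥ 0 and y ∈ ℝ³: c₆ (χ₀ + R_* z)^{-1} (1+|y|)^{-a} ≤ |D_yX(z,y)| ≤ c₇ (1 + χ₀ + R_* z)^{a} (1+|y|)^{-a}, where c₆ = √3 (2^{-ᾱ_N} min{1, a_N})^a/(ᾱ_N + 2) and c₇ = √3 · 2^{ᾱ_N}/min{a₀, a_N}. -/

import Mathlib

open Real

noncomputable section

abbrev E3 := EuclideanSpace ℝ (Fin 3)

/-- The cross product `x × y` in `ℝ³`. -/
def cross3 (x y : E3) : E3 :=
  (WithLp.equiv 2 (Fin 3 → ℝ)).symm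
    ![x 1 * y 2 - x 2 * y 1, x 2 * y 0 - x 0 * y 2, x 0 * y 1 - x 1 * y 0]

/-- The function `g(s) = Σ aᵢ s^{ᾱᵢ}` (with `0⁰ = 1`, as for `Real.rpow`). -/
def gFun (N : ℕ) (α' A : Fin (N + 1) → ℝ) (s : ℝ) : ℝ := ∑ i, A i * s ^ α' i

/-- The Frobenius (Euclidean) norm of the Jacobian matrix of `y ↦ X z y` at `y`. -/
def frobDy (X : ℝ → E3 → E3) (z : ℝ) (y : E3) : ℝ :=
  Real.sqrt (∑ i, ∑ j, (fderiv ℝ (fun y' => X z y') y (EuclideanSpace.single j 1) i) ^ 2)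

/-- `v ↦ k × v` as a continuous linear map. -/
def crossCLM (k : E3) : E3 →L[ℝ] E3 :=
  LinearMap.toContinuousLinearMap
    { toFun := cross3 k
      map_add' := fun x y => by ext i; fin_cases i <;> simp [cross3] <;> ring
      map_smul' := fun c x => by ext i; fin_cases i <;> simp [cross3] <;> ring }

@[simp]
lemma crossCLM_apply (k v : E3) : crossCLM k v = cross3 k v := rfl

lemma inner_cross3_self (k v : E3) : inner ℝ (cross3 k v) v = 0 := by
  simp [cross3, PiLp.inner_apply, Fin.sum_univ_three]
  ring

lemma norm_cross3_le (k v : E3) : ‖cross3 k v‖ ≤ ‖k‖ * ‖v‖ := by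
  refine abs_le_of_sq_le_sq' ?_ (by positivity) |>.2
  rw [mul_pow, EuclideanSpace.real_norm_sq_eq, EuclideanSpace.real_norm_sq_eq,
    EuclideanSpace.real_norm_sq_eq]
  simp [cross3, Fin.sum_univ_three]
  nlinarith [sq_nonneg (k 0 * v 0 + k 1 * v 1 + k 2 * v 2)]

/-- The derivative of `gFun`. -/
def gFunDeriv (N : ℕ) (α' A : Fin (N + 1) → ℝ) (s : ℝ) : ℝ :=
  ∑ i, A i * (α' i * s ^ (α' i - 1))

section gFun

variable {N : ℕ} {α' A : Fin (N + 1) → ℝ} {s : ℝ}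

lemma hasDerivAt_gFun (hs : s ≠ 0) :
    HasDerivAt (gFun N α' A) (gFunDeriv N α' A s) s :=
  HasDerivAt.fun_sum fun i _ => (Real.hasDerivAt_rpow_const (Or.inl hs)).const_mul (A i)

lemma continuous_gFun (hα : ∀ i, 0 ≤ α' i) : Continuous (gFun N α' A) :=
  continuous_finsetSum _ fun i _ =>
    continuous_const.mul (Real.continuous_rpow_const (hα i))

lemma gFunDeriv_nonneg (hα : ∀ i, 0 ≤ α' i) (hA : ∀ i, 0 < A i) (hs : 0 ≤ s) :
    0 ≤ gFunDeriv N α' A s :=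
  Finset.sum_nonneg fun i _ =>
    mul_nonneg (hA i).le (mul_nonneg (hα i) (Real.rpow_nonneg hs _))

lemma gFunDeriv_mul_le {β : ℝ} (hβ : ∀ i, α' i ≤ β) (hα : ∀ i, 0 ≤ α' i)
    (hA : ∀ i, 0 < A i) (hs : 0 ≤ s) :
    gFunDeriv N α' A s * s ≤ β * gFun N α' A s := by
  rcases hs.eq_or_lt with rfl | hs
  · have : 0 ≤ β := (hα 0).trans (hβ 0)
    rw [mul_zero]
    exact mul_nonneg this (Finset.sum_nonneg fun i _ =>
      mul_nonneg (hA i).le (Real.rpow_nonneg le_rfl _))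
  · rw [gFunDeriv, gFun, Finset.sum_mul, Finset.mul_sum]
    refine Finset.sum_le_sum fun i _ => ?_
    have h : s ^ (α' i - 1) * s = s ^ α' i := by
      rw [Real.rpow_sub_one hs.ne', div_mul_cancel₀ _ hs.ne']
    have h2 : 0 ≤ A i * s ^ α' i := mul_nonneg (hA i).le (Real.rpow_nonneg hs.le _)
    calc A i * (α' i * s ^ (α' i - 1)) * s = α' i * (A i * (s ^ (α' i - 1) * s)) := by ring
      _ = α' i * (A i * s ^ α' i) := by rw [h]
      _ ≤ β * (A i * s ^ α' i) := mul_le_mul_of_nonneg_right (hβ i) h2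

lemma gFun_le {β : ℝ} (hβ : ∀ i, α' i ≤ β) (hα : ∀ i, 0 ≤ α' i)
    (hA : ∀ i, 0 < A i) (hs : 0 ≤ s) :
    gFun N α' A s ≤ (∑ i, A i) * (1 + s) ^ β := by
  rw [gFun, Finset.sum_mul]
  refine Finset.sum_le_sum fun i _ => mul_le_mul_of_nonneg_left ?_ (hA i).le
  exact (Real.rpow_le_rpow hs (by linarith) (hα i)).trans
    (Real.rpow_le_rpow_of_exponent_le (by linarith) (hβ i))

lemma term_le_gFun (hA : ∀ i, 0 < A i) (hs : 0 ≤ s) (i : Fin (N + 1)) :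
    A i * s ^ α' i ≤ gFun N α' A s :=
  Finset.single_le_sum (f := fun i => A i * s ^ α' i)
    (fun i _ => mul_nonneg (hA i).le (Real.rpow_nonneg hs _)) (Finset.mem_univ i)

lemma le_gFun (hα : ∀ i, 0 ≤ α' i) (hα0 : α' 0 = 0) (hA : ∀ i, 0 < A i) (hs : 0 ≤ s)
    (j : Fin (N + 1)) :
    min (A 0) (A j) * (2 ^ (-α' j) * (1 + s) ^ α' j) ≤ gFun N α' A s := by
  have hm : 0 < min (A 0) (A j) := lt_min (hA 0) (hA j)
  have key : (2 : ℝ) ^ (-α' j) * (1 + s) ^ α' j = ((1 + s) / 2) ^ α' j := by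
    rw [Real.div_rpow (by linarith) (by norm_num), Real.rpow_neg (by norm_num)]
    field_simp
  rw [key]
  rcases le_total s 1 with h | h
  · have h1 : ((1 + s) / 2) ^ α' j ≤ 1 := Real.rpow_le_one (by linarith) (by linarith) (hα j)
    have h2 := term_le_gFun (α' := α') hA hs 0
    rw [hα0, Real.rpow_zero, mul_one] at h2
    calc _ ≤ min (A 0) (A j) * 1 := by gcongr
      _ ≤ A 0 := by rw [mul_one]; exact min_le_left _ _
      _ ≤ _ := h2
  · have h1 : ((1 + s) / 2) ^ α' j ≤ s ^ α' j :=
      Real.rpow_le_rpow (by linarith) (by linarith) (hα j)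
    refine le_trans ?_ (term_le_gFun hA hs j)
    exact mul_le_mul (min_le_right _ _) h1 (Real.rpow_nonneg (by linarith) _) (hA j).le

end gFun

/-- The radial-plus-rotational map `F v = g(|v|) v + r (k × v)`. -/
def fieldMap (N : ℕ) (α' A : Fin (N + 1) → ℝ) (r : ℝ) (k v : E3) : E3 :=
  gFun N α' A ‖v‖ • v + r • cross3 k v

/-- The derivative of `fieldMap` at `v`. -/
def fieldMapDeriv (N : ℕ) (α' A : Fin (N + 1) → ℝ) (r : ℝ) (k v : E3) : E3 →L[ℝ] E3 :=
  gFun N α' A ‖v‖ • ContinuousLinearMap.id ℝ E3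
    + ((gFunDeriv N α' A ‖v‖ * ‖v‖⁻¹) • innerSL ℝ v).smulRight v + r • crossCLM k

section fieldMap

variable {N : ℕ} {α' A : Fin (N + 1) → ℝ} {r : ℝ} {k v : E3}

lemma fieldMapDeriv_apply (w : E3) :
    fieldMapDeriv N α' A r k v w = gFun N α' A ‖v‖ • w
      + (gFunDeriv N α' A ‖v‖ * ‖v‖⁻¹ * inner ℝ v w) • v + r • cross3 k w := by
  simp [fieldMapDeriv]

lemma hasFDerivAt_norm_of_ne_zero {E : Type*} [NormedAddCommGroup E] [InnerProductSpace ℝ E]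
    {x : E} (hx : x ≠ 0) : HasFDerivAt (fun x : E => ‖x‖) (‖x‖⁻¹ • innerSL ℝ x) x := by
  have h := (hasStrictFDerivAt_norm_sq x).hasFDerivAt.sqrt (by simpa using hx)
  simp only [Real.sqrt_sq (norm_nonneg _)] at h
  convert h using 1
  ext w
  simp
  ring

lemma hasFDerivAt_fieldMap (hα : ∀ i, 0 ≤ α' i) :
    HasFDerivAt (fieldMap N α' A r k) (fieldMapDeriv N α' A r k v) v := by
  have hc : HasFDerivAt (fun v => r • cross3 k v) (r • crossCLM k) v :=
    (r • crossCLM k).hasFDerivAt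
  refine HasFDerivAt.add ?_ hc
  by_cases hv : v = 0
  · subst hv
    have hg : Continuous fun v : E3 => gFun N α' A ‖v‖ := (continuous_gFun hα).comp continuous_norm
    rw [hasFDerivAt_iff_isLittleO_nhds_zero]
    have h1 : (fun h : E3 => gFun N α' A ‖h‖ - gFun N α' A ‖(0 : E3)‖)
        =o[nhds 0] fun _ => (1 : ℝ) := by
      rw [Asymptotics.isLittleO_one_iff]
      exact tendsto_sub_nhds_zero_iff.2 (hg.tendsto 0)
    have h2 := h1.smul_isBigO (Asymptotics.isBigO_refl (fun h : E3 => h) (nhds 0))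
    simpa [sub_smul] using h2
  · have hn := (hasDerivAt_gFun (α' := α') (A := A) (norm_ne_zero_iff.2 hv)).comp_hasFDerivAt v
      (hasFDerivAt_norm_of_ne_zero hv)
    have h := hn.smul (hasFDerivAt_id v)
    rw [smul_smul] at h
    exact h

lemma norm_mul_gFun_le_norm_fieldMapDeriv (hα : ∀ i, 0 ≤ α' i) (hA : ∀ i, 0 < A i) (w : E3) :
    gFun N α' A ‖v‖ * ‖w‖ ≤ ‖fieldMapDeriv N α' A r k v w‖ := by
  rcases eq_or_ne w 0 with rfl | hw
  · simp
  have hw' : 0 < ‖w‖ := norm_pos_iff.2 hw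
  have h1 : inner ℝ (fieldMapDeriv N α' A r k v w) w = gFun N α' A ‖v‖ * ‖w‖ ^ 2
      + gFunDeriv N α' A ‖v‖ * ‖v‖⁻¹ * inner ℝ v w ^ 2 := by
    rw [fieldMapDeriv_apply, inner_add_left, inner_add_left, real_inner_smul_left,
      real_inner_smul_left, real_inner_smul_left, inner_cross3_self, real_inner_self_eq_norm_sq]
    ring
  have h2 := real_inner_le_norm (fieldMapDeriv N α' A r k v w) w
  have h3 : 0 ≤ gFunDeriv N α' A ‖v‖ * ‖v‖⁻¹ * inner ℝ v w ^ 2 :=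
    mul_nonneg (mul_nonneg (gFunDeriv_nonneg hα hA (norm_nonneg v)) (by positivity)) (by positivity)
  exact le_of_mul_le_mul_right (by nlinarith) hw'

lemma norm_fieldMapDeriv_le (hk : ‖k‖ = 1) (hr : 0 ≤ r) (hα : ∀ i, 0 ≤ α' i)
    (hA : ∀ i, 0 < A i) {β : ℝ} (hβ : ∀ i, α' i ≤ β) (w : E3) :
    ‖fieldMapDeriv N α' A r k v w‖ ≤ ((1 + β) * gFun N α' A ‖v‖ + r) * ‖w‖ := by
  have hg : 0 ≤ gFun N α' A ‖v‖ := Finset.sum_nonneg fun i _ =>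
    mul_nonneg (hA i).le (Real.rpow_nonneg (norm_nonneg v) _)
  have hd := gFunDeriv_nonneg hα hA (norm_nonneg v)
  have h2 : ‖(gFunDeriv N α' A ‖v‖ * ‖v‖⁻¹ * inner ℝ v w) • v‖
      ≤ β * gFun N α' A ‖v‖ * ‖w‖ := by
    rcases eq_or_ne v 0 with rfl | hv
    · have : 0 ≤ β := (hα 0).trans (hβ 0)
      simp only [smul_zero, norm_zero] at hg ⊢
      positivity
    have hv' : 0 < ‖v‖ := norm_pos_iff.2 hv
    rw [norm_smul, norm_mul, norm_mul, norm_inv, norm_norm, Real.norm_of_nonneg hd]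
    calc gFunDeriv N α' A ‖v‖ * ‖v‖⁻¹ * ‖inner ℝ v w‖ * ‖v‖
        ≤ gFunDeriv N α' A ‖v‖ * ‖v‖⁻¹ * (‖v‖ * ‖w‖) * ‖v‖ := by
          gcongr
          exact norm_inner_le_norm v w
      _ = gFunDeriv N α' A ‖v‖ * ‖v‖ * ‖w‖ := by field_simp
      _ ≤ _ := by
          exact mul_le_mul_of_nonneg_right (gFunDeriv_mul_le hβ hα hA (norm_nonneg v))
            (norm_nonneg w)
  have h3 : ‖r • cross3 k w‖ ≤ r * ‖w‖ := by
    rw [norm_smul, Real.norm_of_nonneg hr]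
    gcongr
    simpa [hk] using norm_cross3_le k w
  rw [fieldMapDeriv_apply]
  refine (norm_add₃_le).trans ?_
  rw [norm_smul (gFun N α' A ‖v‖), Real.norm_of_nonneg hg]
  linarith

lemma norm_fieldMap_le (hk : ‖k‖ = 1) (hr : 0 ≤ r) (hA : ∀ i, 0 < A i) :
    ‖fieldMap N α' A r k v‖ ≤ (gFun N α' A ‖v‖ + r) * ‖v‖ := by
  have hg : 0 ≤ gFun N α' A ‖v‖ := Finset.sum_nonneg fun i _ =>
    mul_nonneg (hA i).le (Real.rpow_nonneg (norm_nonneg v) _)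
  refine (norm_add_le _ _).trans ?_
  rw [norm_smul, norm_smul, Real.norm_of_nonneg hg, Real.norm_of_nonneg hr, add_mul]
  gcongr
  simpa [hk] using norm_cross3_le k v

lemma le_norm_fieldMap : gFun N α' A ‖v‖ * ‖v‖ ≤ ‖fieldMap N α' A r k v‖ := by
  rcases eq_or_ne v 0 with rfl | hv
  · simp
  have h1 : inner ℝ (fieldMap N α' A r k v) v = gFun N α' A ‖v‖ * ‖v‖ ^ 2 := by
    rw [fieldMap, inner_add_left, real_inner_smul_left, real_inner_smul_left, inner_cross3_self,
      real_inner_self_eq_norm_sq]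
    ring
  have h2 := real_inner_le_norm (fieldMap N α' A r k v) v
  exact le_of_mul_le_mul_right (by nlinarith) (norm_pos_iff.2 hv)

end fieldMap

lemma frobDy_eq (X : ℝ → E3 → E3) (z : ℝ) (y : E3) :
    frobDy X z y = √(∑ j, ‖fderiv ℝ (fun y' => X z y') y (EuclideanSpace.single j 1)‖ ^ 2) := by
  rw [frobDy, Finset.sum_comm]
  simp only [EuclideanSpace.real_norm_sq_eq]

lemma frobDy_le {X : ℝ → E3 → E3} {z : ℝ} {y : E3} {C : ℝ} (hC : 0 ≤ C)
    (h : ∀ j, ‖fderiv ℝ (fun y' => X z y') y (EuclideanSpace.single j 1)‖ ≤ C) :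
    frobDy X z y ≤ √3 * C := by
  rw [frobDy_eq, ← Real.sqrt_sq hC, ← Real.sqrt_mul (by norm_num)]
  refine Real.sqrt_le_sqrt ((Finset.sum_le_sum fun j _ =>
    pow_le_pow_left₀ (norm_nonneg _) (h j) 2).trans ?_)
  simp

lemma le_frobDy {X : ℝ → E3 → E3} {z : ℝ} {y : E3} {C : ℝ} (hC : 0 ≤ C)
    (h : ∀ j, C ≤ ‖fderiv ℝ (fun y' => X z y') y (EuclideanSpace.single j 1)‖) :
    √3 * C ≤ frobDy X z y := by
  rw [frobDy_eq, ← Real.sqrt_sq hC, ← Real.sqrt_mul (by norm_num)]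
  refine Real.sqrt_le_sqrt (le_trans ?_ (Finset.sum_le_sum fun j _ =>
    pow_le_pow_left₀ hC (h j) 2))
  simp

lemma one_add_rpow_le {p s : ℝ} (hp : 1 ≤ p) (hs : 0 ≤ s) :
    2 ^ (1 - p) * (1 + s) ^ p ≤ 1 + s ^ p := by
  have h : (1 + s) ^ p ≤ 2 ^ (p - 1) * (1 + s ^ p) := by
    lift s to NNReal using hs
    simpa using NNReal.coe_le_coe.2 (NNReal.rpow_add_le_mul_rpow_add_rpow 1 s hp)
  calc (2 : ℝ) ^ (1 - p) * (1 + s) ^ p ≤ 2 ^ (1 - p) * (2 ^ (p - 1) * (1 + s ^ p)) := by gcongr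
    _ = 1 + s ^ p := by
      rw [← mul_assoc, ← Real.rpow_add (by norm_num)]
      simp

theorem stmt2
    (N : ℕ) (hN : 1 ≤ N)
    (α' : Fin (N + 1) → ℝ) (hα0 : α' 0 = 0) (hαmono : StrictMono α')
    (A : Fin (N + 1) → ℝ) (hA : ∀ i, 0 < A i)
    (k : E3) (hk : ‖k‖ = 1)
    (Rs : ℝ) (hRs : 0 ≤ Rs)
    (X : ℝ → E3 → E3)
    (hX : ∀ z y, gFun N α' A ‖X z y‖ • X z y + (Rs * z) • cross3 k (X z y) = y)
    (hXC1 : ContDiff ℝ 1 (fun p : ℝ × E3 => X p.1 p.2))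
    (a χ₀ c₆ c₇ : ℝ)
    (ha : a = α' (Fin.last N) / (1 + α' (Fin.last N)))
    (hχ₀ : χ₀ = ∑ i, A i)
    (hc₆ : c₆ = Real.sqrt 3 * (2 ^ (-α' (Fin.last N)) * min 1 (A (Fin.last N))) ^ a
        / (α' (Fin.last N) + 2))
    (hc₇ : c₇ = Real.sqrt 3 * 2 ^ (α' (Fin.last N)) / min (A 0) (A (Fin.last N)))
    (z : ℝ) (hz : 0 ≤ z) (y : E3) :
    c₆ * (χ₀ + Rs * z) ^ (-1 : ℝ) * (1 + ‖y‖) ^ (-a) ≤ frobDy X z y ∧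
    frobDy X z y ≤ c₇ * (1 + χ₀ + Rs * z) ^ a * (1 + ‖y‖) ^ (-a) := by
  set β := α' (Fin.last N) with hβdef
  set r := Rs * z with hrdef
  set v := X z y with hvdef
  have hr : 0 ≤ r := mul_nonneg hRs hz
  have hα : ∀ i, 0 ≤ α' i := fun i => hα0 ▸ hαmono.monotone (Fin.zero_le i)
  have hβ : ∀ i, α' i ≤ β := fun i => hαmono.monotone (Fin.le_last i)
  have hβ0 : 0 ≤ β := hα _
  have hβa : (1 + β) * a = β := by rw [ha]; field_simp
  have ha0 : 0 ≤ a := by rw [ha]; positivity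
  have hχ : 0 < χ₀ := hχ₀ ▸ Finset.sum_pos (fun i _ => hA i) Finset.univ_nonempty
  have hFX : ∀ y, fieldMap N α' A r k (X z y) = y := hX z
  have hs : 0 ≤ ‖v‖ := norm_nonneg v
  set S := 1 + ‖v‖ with hS
  have hS0 : 0 < S := by positivity
  have hS1 : 1 ≤ S := by linarith
  have hSβ : 1 ≤ S ^ β := Real.one_le_rpow hS1 hβ0
  have hSa : (S ^ (1 + β)) ^ a = S ^ β := by rw [← Real.rpow_mul hS0.le, hβa]
  have hSβ1 : S ^ (1 + β) = S * S ^ β := by rw [Real.rpow_add hS0, Real.rpow_one]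
  have hY : 0 < 1 + ‖y‖ := by positivity
  have hg_le : gFun N α' A ‖v‖ ≤ χ₀ * S ^ β := hχ₀ ▸ gFun_le hβ hα hA hs
  have hg_ge : min (A 0) (A (Fin.last N)) * (2 ^ (-β) * S ^ β) ≤ gFun N α' A ‖v‖ :=
    le_gFun hα hα0 hA hs (Fin.last N)
  have hm : 0 < min (A 0) (A (Fin.last N)) := lt_min (hA _) (hA _)
  have hg0 : 0 < gFun N α' A ‖v‖ := lt_of_lt_of_le (by positivity) hg_ge
  have hXd : DifferentiableAt ℝ (fun y' => X z y') y :=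
    ((hXC1.differentiable one_ne_zero).comp
      ((differentiable_const z).prodMk differentiable_id)).differentiableAt
  have hinv : ∀ e, fieldMapDeriv N α' A r k v (fderiv ℝ (fun y' => X z y') y e) = e := by
    intro e
    have h1 : HasFDerivAt (fun y' => fieldMap N α' A r k (X z y')) _ y :=
      (hasFDerivAt_fieldMap (k := k) (r := r) (A := A) hα).comp y hXd.hasFDerivAt
    simp only [hFX] at h1
    exact congrArg (fun L : E3 →L[ℝ] E3 => L e) (h1.unique (hasFDerivAt_id y))
  have hnorm : ∀ j : Fin 3, ‖(EuclideanSpace.single j 1 : E3)‖ = 1 := fun j => by simp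
  constructor
  · set m := 2 ^ (-β) * min 1 (A (Fin.last N)) with hm_def
    have hm1 : 0 < min 1 (A (Fin.last N)) := lt_min one_pos (hA _)
    have hlow : m * S ^ (1 + β) ≤ 1 + ‖y‖ := by
      have h1 : A (Fin.last N) * ‖v‖ ^ (1 + β) ≤ ‖y‖ := by
        have h2 := le_norm_fieldMap (N := N) (α' := α') (A := A) (r := r) (k := k) (v := v)
        rw [hFX] at h2
        refine le_trans ?_ h2
        rw [add_comm 1 β, Real.rpow_add_one' hs (by positivity), ← mul_assoc]
        gcongr
        exact term_le_gFun hA hs _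
      have h3 := one_add_rpow_le (p := 1 + β) (by linarith) hs
      rw [show 1 - (1 + β) = -β by ring] at h3
      calc m * S ^ (1 + β) = min 1 (A (Fin.last N)) * (2 ^ (-β) * S ^ (1 + β)) := by
            rw [hm_def]; ring
        _ ≤ min 1 (A (Fin.last N)) * (1 + ‖v‖ ^ (1 + β)) := by gcongr
        _ = min 1 (A (Fin.last N)) + min 1 (A (Fin.last N)) * ‖v‖ ^ (1 + β) := by ring
        _ ≤ 1 + A (Fin.last N) * ‖v‖ ^ (1 + β) := by
            gcongr
            exacts [min_le_left _ _, min_le_right _ _]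
        _ ≤ 1 + ‖y‖ := by linarith
    have hlow' : m ^ a * S ^ β ≤ (1 + ‖y‖) ^ a := by
      rw [← hSa, ← Real.mul_rpow (by positivity) (by positivity)]
      exact Real.rpow_le_rpow (by positivity) hlow ha0
    have hD : (1 + β) * gFun N α' A ‖v‖ + r ≤ (β + 2) * (χ₀ + r) * S ^ β := by
      have h1 : r ≤ r * S ^ β := le_mul_of_one_le_right hr hSβ
      have h2 : 0 ≤ (1 + β) * (r * S ^ β) := by positivity
      have h3 : 0 ≤ χ₀ * S ^ β := by positivity
      have h4 : (1 + β) * gFun N α' A ‖v‖ ≤ (1 + β) * (χ₀ * S ^ β) := by gcongr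
      linarith
    have hDpos : 0 < (1 + β) * gFun N α' A ‖v‖ + r := by positivity
    have hcol : ∀ j, ((1 + β) * gFun N α' A ‖v‖ + r)⁻¹
        ≤ ‖fderiv ℝ (fun y' => X z y') y (EuclideanSpace.single j 1)‖ := by
      intro j
      have h1 := norm_fieldMapDeriv_le (v := v) hk hr hα hA hβ
        (fderiv ℝ (fun y' => X z y') y (EuclideanSpace.single j 1))
      rw [hinv, hnorm] at h1
      rwa [inv_le_iff_one_le_mul₀' hDpos]
    refine le_trans ?_ (le_frobDy (by positivity) hcol)
    rw [hc₆, Real.rpow_neg_one, Real.rpow_neg hY.le, mul_div_assoc, mul_assoc, mul_assoc]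
    refine mul_le_mul_of_nonneg_left ?_ (Real.sqrt_nonneg _)
    have hχr : 0 < χ₀ + r := by positivity
    have hYa : 0 < (1 + ‖y‖) ^ a := by positivity
    calc m ^ a / (β + 2) * ((χ₀ + r)⁻¹ * ((1 + ‖y‖) ^ a)⁻¹)
        = m ^ a * ((1 + ‖y‖) ^ a)⁻¹ * ((β + 2) * (χ₀ + r))⁻¹ := by
          field_simp
      _ ≤ (S ^ β)⁻¹ * ((β + 2) * (χ₀ + r))⁻¹ := by
          gcongr
          rw [← div_eq_mul_inv, div_le_iff₀ hYa, ← div_eq_inv_mul, le_div_iff₀ (by positivity)]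
          exact hlow'
      _ = ((β + 2) * (χ₀ + r) * S ^ β)⁻¹ := by
          rw [← mul_inv, mul_comm]
      _ ≤ _ := by gcongr
  · have hcol : ∀ j, ‖fderiv ℝ (fun y' => X z y') y (EuclideanSpace.single j 1)‖
        ≤ (gFun N α' A ‖v‖)⁻¹ := by
      intro j
      have h1 := norm_mul_gFun_le_norm_fieldMapDeriv (r := r) (k := k) (v := v) hα hA
        (fderiv ℝ (fun y' => X z y') y (EuclideanSpace.single j 1))
      rw [hinv, hnorm] at h1
      rwa [← one_div, le_div_iff₀' hg0]
    refine (frobDy_le (by positivity) hcol).trans ?_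
    rw [hc₇, mul_div_assoc, mul_assoc, mul_assoc]
    refine mul_le_mul_of_nonneg_left ?_ (Real.sqrt_nonneg _)
    have hupp : 1 + ‖y‖ ≤ (1 + χ₀ + r) * S ^ (1 + β) := by
      have h1 := norm_fieldMap_le (v := v) (α' := α') hk hr hA
      rw [hFX] at h1
      have h2 : (gFun N α' A ‖v‖ + r) * ‖v‖ ≤ (χ₀ * S ^ β + r * S ^ β) * S := by
        gcongr
        · exact le_mul_of_one_le_right hr hSβ
        · linarith
      have h3 : 1 ≤ S * S ^ β := one_le_mul_of_one_le_of_one_le hS1 hSβ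
      rw [hSβ1]
      linarith
    have hupp' : (1 + ‖y‖) ^ a ≤ (1 + χ₀ + r) ^ a * S ^ β := by
      rw [← hSa, ← Real.mul_rpow (by positivity) (by positivity)]
      exact Real.rpow_le_rpow hY.le hupp ha0
    have hYa : 0 < (1 + ‖y‖) ^ a := by positivity
    calc (gFun N α' A ‖v‖)⁻¹
        ≤ (min (A 0) (A (Fin.last N)) * (2 ^ (-β) * S ^ β))⁻¹ := by gcongr
      _ = 2 ^ β / min (A 0) (A (Fin.last N)) * (S ^ β)⁻¹ := by
          rw [Real.rpow_neg (by norm_num)]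
          field_simp
      _ ≤ 2 ^ β / min (A 0) (A (Fin.last N)) * ((1 + χ₀ + r) ^ a * (1 + ‖y‖) ^ (-a)) := by
          gcongr
          rw [Real.rpow_neg hY.le, ← div_eq_mul_inv, le_div_iff₀ hYa, ← div_eq_inv_mul,
            div_le_iff₀ (by positivity)]
          exact hupp'
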